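/- Let T be a tree and let S be a connected component of the subgraph of T induced by the closed neighborhood N[Supp(T)]. Then S, regarded as a tree in its own right, is an S-tree: the closed neighborhood of Supp(S) in S equals V(S). -/

import Mathlib

open scoped Classical

namespace NullDecomp

variable {V : Type*}

/-- The null space of the real adjacency matrix of a graph. -/
def nullSpace [Fintype V] (G : SimpleGraph V) : Set (V → ℝ) :=
  {x | Matrix.mulVec (G.adjMatrix ℝ) x = 0}

/-- The support of the null space: vertices with a nonzero entry in some null vector. -/
def supportSet [Fintype V] (G : SimpleGraph V) : Set V :=
  {v | ∃ x ∈ nullSpace G, x v ≠ 0}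

/-- The (open) neighborhood of a set of vertices. -/
def nbhdSet (G : SimpleGraph V) (A : Set V) : Set V :=
  {v | ∃ u ∈ A, G.Adj u v}

/-- The closed neighborhood of a set of vertices. -/
def closedNbhd (G : SimpleGraph V) (A : Set V) : Set V :=
  A ∪ nbhdSet G A

/-- The core of a graph: the neighborhood of the support of the null space. -/
def coreSet [Fintype V] (G : SimpleGraph V) : Set V :=
  nbhdSet G (supportSet G)

/-- A tree is an S-tree if the closed neighborhood of its support is everything. -/
def IsSTree [Fintype V] (G : SimpleGraph V) : Prop :=
  G.IsTree ∧ closedNbhd G (supportSet G) = Set.univ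

/-- A matching: a set of edges of `G`, pairwise disjoint. -/
def IsMatchingSet (G : SimpleGraph V) (M : Finset (Sym2 V)) : Prop :=
  (↑M : Set (Sym2 V)) ⊆ G.edgeSet ∧
    ∀ e ∈ M, ∀ f ∈ M, e ≠ f → ∀ v : V, v ∈ e → v ∉ f

/-- A maximum matching. -/
def IsMaxMatching [Fintype V] (G : SimpleGraph V) (M : Finset (Sym2 V)) : Prop :=
  IsMatchingSet G M ∧ ∀ M' : Finset (Sym2 V), IsMatchingSet G M' → M'.card ≤ M.card

/-- The matching number. -/
noncomputable def matchingNumber [Fintype V] (G : SimpleGraph V) : ℕ :=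
  sSup {n | ∃ M : Finset (Sym2 V), IsMatchingSet G M ∧ M.card = n}

/-- An independent set of vertices. -/
def IsIndep (G : SimpleGraph V) (A : Set V) : Prop :=
  ∀ u ∈ A, ∀ w ∈ A, ¬ G.Adj u w

/-- The independence number. -/
noncomputable def indepNumber [Fintype V] (G : SimpleGraph V) : ℕ :=
  sSup {n | ∃ A : Set V, IsIndep G A ∧ A.ncard = n}

/-- A vertex cover. -/
def IsVertexCover (G : SimpleGraph V) (Cs : Set V) : Prop :=
  ∀ e ∈ G.edgeSet, ∃ v ∈ Cs, v ∈ e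

/-- The vertex cover number. -/
noncomputable def coverNumber [Fintype V] (G : SimpleGraph V) : ℕ :=
  sInf {n | ∃ Cs : Set V, IsVertexCover G Cs ∧ Cs.ncard = n}

/-- The nullity of a graph: dimension of the kernel of its adjacency matrix. -/
noncomputable def nullity [Fintype V] (G : SimpleGraph V) : ℕ :=
  Module.finrank ℝ (LinearMap.ker (Matrix.mulVecLin (G.adjMatrix ℝ)))

/-- The number of maximum matchings of a graph. -/
noncomputable def numMaxMatchings [Fintype V] (G : SimpleGraph V) : ℕ :=
  Set.ncard {M : Finset (Sym2 V) | IsMaxMatching G M}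

/-- `C` is (the vertex set of) a connected component of the subgraph of `T`
induced by the closed neighborhood of the support of `T`. -/
def IsSComponent [Fintype V] (T : SimpleGraph V) (C : Set V) : Prop :=
  ∃ c : (T.induce (closedNbhd T (supportSet T))).ConnectedComponent,
    C = Subtype.val '' c.supp

/-- `C` is (the vertex set of) a connected component of the subgraph of `T`
induced by the complement of the closed neighborhood of the support of `T`. -/
def IsNComponent [Fintype V] (T : SimpleGraph V) (C : Set V) : Prop :=
  ∃ c : (T.induce ((closedNbhd T (supportSet T))ᶜ)).ConnectedComponent,
    C = Subtype.val '' c.supp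

/-- The zero-extension to `ℝ^V` of the null space of the subgraph of `T` induced by `C`:
vectors vanishing outside `C` whose restriction to `C` is a null vector of `T.induce C`. -/
noncomputable def extNull [Fintype V] (T : SimpleGraph V) (C : Set V) : Submodule ℝ (V → ℝ) :=
  LinearMap.ker ((Matrix.mulVecLin ((T.induce C).adjMatrix ℝ)).comp
      (LinearMap.funLeft ℝ ℝ (Subtype.val : ↥C → V))) ⊓
  LinearMap.ker (LinearMap.funLeft ℝ ℝ (Subtype.val : ↥(Cᶜ) → V))

theorem IsSComponent.subset_closedNbhd [Fintype V] {T : SimpleGraph V} {C : Set V}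
    (hC : IsSComponent T C) : C ⊆ closedNbhd T (supportSet T) := by
  obtain ⟨c, rfl⟩ := hC
  rintro _ ⟨u, -, rfl⟩
  exact u.2

theorem IsSComponent.mem_of_adj [Fintype V] {T : SimpleGraph V} {C : Set V}
    (hC : IsSComponent T C) {u w : V} (hu : u ∈ C) (huw : T.Adj u w)
    (hw : w ∈ closedNbhd T (supportSet T)) : w ∈ C := by
  obtain ⟨c, rfl⟩ := hC
  obtain ⟨u, hu, rfl⟩ := hu
  have hadj : (T.induce (closedNbhd T (supportSet T))).Adj u ⟨w, hw⟩ := huw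
  exact ⟨⟨w, hw⟩, c.mem_supp_of_adj_mem_supp hu hadj, rfl⟩

theorem mem_nullSpace_iff [Fintype V] {G : SimpleGraph V} {x : V → ℝ} :
    x ∈ nullSpace G ↔ ∀ u, ∑ w, (if G.Adj u w then x w else 0) = 0 := by
  simp [nullSpace, funext_iff, Matrix.mulVec, dotProduct, SimpleGraph.adjMatrix_apply]

/-- Null vectors of `T` restrict to null vectors of each component of the subgraph induced by
`N[Supp(T)]`. -/
theorem IsSComponent.restrict_mem_nullSpace [Fintype V] {T : SimpleGraph V} {C : Set V}
    (hC : IsSComponent T C) {x : V → ℝ} (hx : x ∈ nullSpace T) :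
    (fun u : C => x u) ∈ nullSpace (T.induce C) := by
  rw [mem_nullSpace_iff] at hx ⊢
  intro u
  refine Eq.trans ?_ (hx u)
  refine Finset.sum_of_injOn Subtype.val Subtype.val_injective.injOn (by simp) ?_ (by simp)
  intro w _ hw
  have hwC : w ∉ C := by simpa using hw
  split_ifs with huw
  · by_contra hxw
    exact hwC (hC.mem_of_adj u.2 huw (Or.inl ⟨x, mem_nullSpace_iff.2 hx, hxw⟩))
  · rfl

theorem IsSComponent.mem_supportSet_induce [Fintype V] {T : SimpleGraph V} {C : Set V}
    (hC : IsSComponent T C) {u : C} (hu : (u : V) ∈ supportSet T) :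
    u ∈ supportSet (T.induce C) := by
  obtain ⟨x, hx, hxu⟩ := hu
  exact ⟨_, hC.restrict_mem_nullSpace hx, hxu⟩

/-- Every connected component of the subgraph of a tree `T` induced by
`N[Supp(T)]`, regarded as a graph in its own right, is an S-tree. -/
theorem stmt12 [Fintype V] (T : SimpleGraph V) (hT : T.IsTree)
    (C : Set V) (hC : IsSComponent T C) :
    closedNbhd (T.induce C) (supportSet (T.induce C)) = Set.univ := by
  refine Set.eq_univ_of_forall fun u => ?_
  rcases hC.subset_closedNbhd u.2 with hu | ⟨s, hs, hsu⟩
  · exact Or.inl (hC.mem_supportSet_induce hu)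
  · exact Or.inr ⟨⟨s, hC.mem_of_adj u.2 hsu.symm (Or.inl hs)⟩,
      hC.mem_supportSet_induce hs, hsu⟩

end NullDecomp
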